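/- Let z ∈ ℂ and k ≥ 0. Suppose w : ℕ → ℂ satisfies w(k) = 0, w(k+1) = 1, and z·w(n) = λ_{n−1}·w(n−1) + β_n·w(n) + d·λ_n·w(n+1) for all n ≥ k+1. Then w(n) = λ_k·(p_k(z)·q_n(z) − q_k(z)·p_n(z))/√(d^{n−k−1}) for all n ≥ k+1. Consequently, for any vertex u of Γ_d of length k+1, the function f : Γ_d → ℂ given by f(y) = w(|y|) for y ∈ Γ_u and f(y) = 0 otherwise satisfies Σ_{y ∈ Γ_d} |f(y)|² = λ_k²·Σ_{n=k+1}^∞ |p_k(z)·q_n(z) − q_k(z)·p_n(z)|² (as an equality of values in [0, ∞]). -/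

import Mathlib

/-- The solutions `p` and `q` of the three-term recurrence have constant Wronskian
`λ_n (p_n q_{n+1} - q_n p_{n+1}) = 1`. -/
theorem wronskian_eq_one {s : ℂ} (hs : s ≠ 0) {a b : ℕ → ℂ} (ha : ∀ n, a n ≠ 0) {z : ℂ}
    {p q : ℕ → ℂ} (hp0 : p 0 = 1) (hq0 : q 0 = 0) (hq1 : q 1 = 1 / a 0)
    (hp : ∀ n, z * p (n + 1) = s * a n * p n + b (n + 1) * p (n + 1) + s * a (n + 1) * p (n + 2))
    (hq : ∀ n, z * q (n + 1) = s * a n * q n + b (n + 1) * q (n + 1) + s * a (n + 1) * q (n + 2))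
    (n : ℕ) : a n * (p n * q (n + 1) - q n * p (n + 1)) = 1 := by
  induction n with
  | zero =>
    have := ha 0
    simp only [hp0, hq0, zero_add, hq1]
    field_simp
    ring
  | succ n ih =>
    apply mul_left_cancel₀ hs
    linear_combination s * ih + q (n + 1) * hp n - p (n + 1) * hq n

/-- The solution `w` of the recurrence on the subtree, rescaled by powers of `s = √d`, is a
multiple of `p_k q_n - q_k p_n`. -/
theorem pow_mul_solution_eq {s : ℂ} (hs : s ≠ 0) {a b : ℕ → ℂ} (ha : ∀ n, a n ≠ 0) {z : ℂ}
    {p q w : ℕ → ℂ} {k : ℕ}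
    (hp : ∀ n, z * p (n + 1) = s * a n * p n + b (n + 1) * p (n + 1) + s * a (n + 1) * p (n + 2))
    (hq : ∀ n, z * q (n + 1) = s * a n * q n + b (n + 1) * q (n + 1) + s * a (n + 1) * q (n + 2))
    (hW : a k * (p k * q (k + 1) - q k * p (k + 1)) = 1)
    (hwk : w k = 0) (hwk1 : w (k + 1) = 1)
    (hw : ∀ n, k ≤ n →
      z * w (n + 1) = a n * w n + b (n + 1) * w (n + 1) + s ^ 2 * a (n + 1) * w (n + 2))
    (n : ℕ) : s ^ n * w (k + n) = s * (a k * (p k * q (k + n) - q k * p (k + n))) := by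
  induction n using Nat.twoStepInduction with
  | zero => simp [hwk, mul_comm]
  | one => simp [hW, hwk1]
  | more n ih₀ ih₁ =>
    have hwn := hw (k + n) (Nat.le_add_right k n)
    rw [← add_assoc] at ih₁ ⊢
    apply mul_left_cancel₀ (mul_ne_zero hs (ha (k + n + 1)))
    linear_combination (-s ^ (n + 1)) * hwn - s * a (k + n) * ih₀
      + (z - b (k + n + 1)) * ih₁ + s * a k * p k * hq (k + n) - s * a k * q k * hp (k + n)

/-- There are `card α ^ n` words of length `n`, so a radial function on words sums to
`∑ card α ^ n * g n`. -/
theorem tsum_list_length {α : Type*} [Fintype α] (g : ℕ → ENNReal) :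
    ∑' l : List α, g l.length = ∑' n, (Fintype.card α : ENNReal) ^ n * g n := by
  rw [← (Equiv.sigmaFiberEquiv (List.length : List α → ℕ)).tsum_eq, ENNReal.tsum_sigma']
  refine tsum_congr fun n => ?_
  have hcard : ENat.card {l : List α // l.length = n} = ((Fintype.card α ^ n : ℕ) : ℕ∞) := by
    rw [← card_vector (α := α) n, ← ENat.card_eq_coe_fintype_card]
    rfl
  have hconst : ∀ l : {l : List α // l.length = n},
      g (Equiv.sigmaFiberEquiv (List.length : List α → ℕ) ⟨n, l⟩).length = g n :=
    fun l => congrArg g l.2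
  rw [tsum_congr hconst, ENNReal.tsum_const, hcard]
  simp

/-- A function supported on the words extending `u` sums over the words `u ++ t`. -/
theorem tsum_list_prefix {α : Type*} (u : List α) {f : List α → ENNReal}
    (hf : ∀ y, ¬ u <+: y → f y = 0) : ∑' y, f y = ∑' t, f (u ++ t) := by
  refine ((List.append_right_injective u).tsum_eq fun y hy => ?_).symm
  by_contra h
  exact hy (hf y fun ⟨t, ht⟩ => h ⟨t, ht⟩)

/-- Solutions of the truncated recurrence on the subtree below a vertex of length
`k+1` are expressed through the orthogonal polynomials `p_n`, `q_n` of the radial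
matrix `J^r`, and the `ℓ²`-mass of the corresponding function on `Γ_d` (vertices =
finite words over `Fin d`) equals `λ_k²·Σ_{n≥k+1} |p_k q_n − q_k p_n|²` in `[0,∞]`. -/
theorem stmt8 (d : ℕ) (hd : 2 ≤ d) (lam beta : ℕ → ℝ) (hlam : ∀ n, 0 < lam n)
    (z : ℂ) (p q : ℕ → ℂ) (hp0 : p 0 = 1)
    (hprec : ∀ n : ℕ,
      z * p n = (if n = 0 then 0 else ((Real.sqrt d * lam (n - 1) : ℝ) : ℂ) * p (n - 1))
        + (beta n : ℂ) * p n + ((Real.sqrt d * lam n : ℝ) : ℂ) * p (n + 1))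
    (hq0 : q 0 = 0) (hq1 : q 1 = 1 / (lam 0 : ℂ))
    (hqrec : ∀ n : ℕ, 1 ≤ n →
      z * q n = ((Real.sqrt d * lam (n - 1) : ℝ) : ℂ) * q (n - 1)
        + (beta n : ℂ) * q n + ((Real.sqrt d * lam n : ℝ) : ℂ) * q (n + 1))
    (k : ℕ) (w : ℕ → ℂ) (hwk : w k = 0) (hwk1 : w (k + 1) = 1)
    (hwrec : ∀ n : ℕ, k + 1 ≤ n →
      z * w n = (lam (n - 1) : ℂ) * w (n - 1) + (beta n : ℂ) * w n
        + (d : ℂ) * (lam n : ℂ) * w (n + 1)) :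
    (∀ n : ℕ, k + 1 ≤ n →
      w n = (lam k : ℂ) * (p k * q n - q k * p n)
        / ((Real.sqrt (d ^ (n - k - 1)) : ℝ) : ℂ)) ∧
    (∀ u : List (Fin d), u.length = k + 1 →
      ∑' y : List (Fin d),
          ((‖(if u <+: y then w y.length else 0 : ℂ)‖₊ : ENNReal) ^ 2)
        = (‖lam k‖₊ : ENNReal) ^ 2 *
            ∑' n : ℕ, ((‖p k * q (n + (k + 1)) - q k * p (n + (k + 1))‖₊ : ENNReal) ^ 2)) := by
  have hd0 : (0 : ℝ) < d := by exact_mod_cast (by omega : 0 < d)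
  have hs0 : 0 < Real.sqrt d := Real.sqrt_pos.2 hd0
  have hs : ((Real.sqrt d : ℝ) : ℂ) ≠ 0 := by exact_mod_cast hs0.ne'
  have hs2 : ((Real.sqrt d : ℝ) : ℂ) ^ 2 = d := by exact_mod_cast Real.sq_sqrt hd0.le
  have ha : ∀ n, (lam n : ℂ) ≠ 0 := fun n => by exact_mod_cast (hlam n).ne'
  have hp : ∀ n, z * p (n + 1) = (Real.sqrt d : ℝ) * (lam n : ℂ) * p n
      + (beta (n + 1) : ℂ) * p (n + 1) + (Real.sqrt d : ℝ) * (lam (n + 1) : ℂ) * p (n + 2) :=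
    fun n => by simpa using hprec (n + 1)
  have hq : ∀ n, z * q (n + 1) = (Real.sqrt d : ℝ) * (lam n : ℂ) * q n
      + (beta (n + 1) : ℂ) * q (n + 1) + (Real.sqrt d : ℝ) * (lam (n + 1) : ℂ) * q (n + 2) :=
    fun n => by simpa using hqrec (n + 1) (by omega)
  have hW := wronskian_eq_one hs (b := fun n => (beta n : ℂ)) ha hp0 hq0 hq1 hp hq k
  have key : ∀ n, ((Real.sqrt d : ℝ) : ℂ) ^ n * w (n + (k + 1))
      = lam k * (p k * q (n + (k + 1)) - q k * p (n + (k + 1))) := fun n => by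
    have h := pow_mul_solution_eq hs (b := fun n => (beta n : ℂ)) ha hp hq hW hwk hwk1
      (fun m hm => by simpa [hs2] using hwrec (m + 1) (by omega)) (n + 1)
    rw [show k + (n + 1) = n + (k + 1) by omega] at h
    apply mul_left_cancel₀ hs
    rw [← h]
    ring
  refine ⟨fun n hn => ?_, fun u hu => ?_⟩
  · obtain ⟨m, rfl⟩ := Nat.exists_eq_add_of_le' hn
    have hsqrt : Real.sqrt ((d : ℝ) ^ m) = Real.sqrt d ^ m := by
      rw [Real.sqrt_eq_iff_mul_self_eq (by positivity) (by positivity), ← mul_pow,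
        Real.mul_self_sqrt hd0.le]
    rw [show m + (k + 1) - k - 1 = m by omega, hsqrt, ← key m, Complex.ofReal_pow,
      mul_div_cancel_left₀ _ (pow_ne_zero m hs)]
  · rw [tsum_list_prefix u fun y hy => by simp [hy]]
    simp only [List.prefix_append, if_true, List.length_append, hu, add_comm (k + 1)]
    rw [tsum_list_length fun n => (‖w (n + (k + 1))‖₊ : ENNReal) ^ 2, ← ENNReal.tsum_mul_left]
    refine tsum_congr fun n => ?_
    have hnorm := congrArg (fun x : ℂ => ‖x‖₊ ^ 2) (key n)
    have hsd : ‖((Real.sqrt d : ℝ) : ℂ)‖₊ ^ 2 = (d : NNReal) := by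
      rw [← nnnorm_pow, hs2]
      simp
    simp only [nnnorm_mul, nnnorm_pow, mul_pow, Complex.nnnorm_real] at hnorm hsd
    rw [← pow_mul, mul_comm n 2, pow_mul, hsd] at hnorm
    rw [Fintype.card_fin]
    exact_mod_cast hnorm
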